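/- Let k ≥ 4 be a natural number, let g > 0, and let a, b be reals with 0 < a ≤ b. Let τ₁ and τ₂ be independent real random variables, where τ₁ has the Gamma distribution with shape k and rate g/a and τ₂ has the Gamma distribution with shape k and rate g/b. Then E[min(τ₁, τ₂)] + (b − a)·P(τ₂ < τ₁) ≤ (k/g + 1/√(k − 1))·a. -/

import Mathlib

open MeasureTheory ProbabilityTheory

lemma gammaMeasure_Iic_zero (a r : ℝ) : gammaMeasure a r (Set.Iic 0) = 0 := by
  rw [gammaMeasure, withDensity_apply _ measurableSet_Iic,
    setLIntegral_congr Iio_ae_eq_Iic.symm]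
  exact lintegral_gammaPDF_of_nonpos le_rfl

lemma ae_pos_gammaMeasure (a r : ℝ) : ∀ᵐ x ∂gammaMeasure a r, 0 < x := by
  have h := gammaMeasure_Iic_zero a r
  rw [ae_iff]
  convert h using 2
  ext x
  simp

lemma lintegral_gammaMeasure (a r : ℝ) {f : ℝ → ENNReal} (hf : Measurable f) :
    ∫⁻ x, f x ∂gammaMeasure a r = ∫⁻ x in Set.Ioi 0, gammaPDF a r x * f x := by
  have hm : Measurable (gammaPDF a r) := (measurable_gammaPDFReal a r).ennreal_ofReal
  have h : ∫⁻ x, f x ∂gammaMeasure a r = ∫⁻ x in Set.Ioi 0, f x ∂gammaMeasure a r := by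
    rw [Measure.restrict_eq_self_of_ae_mem (s := Set.Ioi 0) (ae_pos_gammaMeasure a r)]
  rw [h, gammaMeasure, restrict_withDensity measurableSet_Ioi,
    lintegral_withDensity_eq_lintegral_mul _ hm hf]
  rfl

lemma setLIntegral_gammaPDF_Ioi_zero {a r : ℝ} (ha : 0 < a) (hr : 0 < r) :
    ∫⁻ x in Set.Ioi 0, gammaPDF a r x = 1 := by
  have := isProbabilityMeasure_gammaMeasure ha hr
  have h := lintegral_gammaMeasure a r (f := fun _ => 1) measurable_const
  simpa using h.symm

/-- The mean of the Gamma distribution. -/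
lemma lintegral_ofReal_gammaMeasure {a r : ℝ} (ha : 0 < a) (hr : 0 < r) :
    ∫⁻ x, ENNReal.ofReal x ∂gammaMeasure a r = ENNReal.ofReal (a / r) := by
  rw [lintegral_gammaMeasure a r ENNReal.measurable_ofReal]
  have h : ∀ x ∈ Set.Ioi (0 : ℝ), gammaPDF a r x * ENNReal.ofReal x
      = ENNReal.ofReal (a / r) * gammaPDF (a + 1) r x := by
    intro x hx
    have hx : 0 < x := hx
    rw [gammaPDF_of_nonneg hx.le, gammaPDF_of_nonneg hx.le, ← ENNReal.ofReal_mul (by positivity),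
      ← ENNReal.ofReal_mul (by positivity)]
    congr 1
    have hG := Real.Gamma_pos_of_pos ha
    rw [Real.Gamma_add_one ha.ne', Real.rpow_add_one hr.ne', add_sub_cancel_right,
      Real.rpow_sub_one hx.ne']
    field_simp
  rw [setLIntegral_congr_fun measurableSet_Ioi h,
    lintegral_const_mul' _ _ ENNReal.ofReal_ne_top,
    setLIntegral_gammaPDF_Ioi_zero (by positivity) hr, mul_one]

/-- The density of the ratio of two independent Gamma variables of the same integer shape. -/
noncomputable def gammaRatioPDFReal (k : ℕ) (α β r : ℝ) : ℝ :=
  (α * β) ^ k * (Real.Gamma (2 * k) / Real.Gamma k ^ 2) * r ^ (k - 1) / (α * r + β) ^ (2 * k)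

lemma gammaPDFReal_natCast {k : ℕ} (hk : 0 < k) (r : ℝ) {x : ℝ} (hx : 0 ≤ x) :
    gammaPDFReal k r x = r ^ k / Real.Gamma k * x ^ (k - 1) * Real.exp (-(r * x)) := by
  rw [gammaPDFReal, if_pos hx, Real.rpow_natCast, ← Nat.cast_pred hk, Real.rpow_natCast]

lemma gammaPDF_mul_gammaPDF {k : ℕ} (hk : 0 < k) {α β r y : ℝ} (hα : 0 < α) (hβ : 0 < β)
    (hr : 0 < r) (hy : 0 < y) :
    gammaPDF k β y * (ENNReal.ofReal y * gammaPDF k α (y * r))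
      = ENNReal.ofReal (gammaRatioPDFReal k α β r)
        * gammaPDF (2 * k : ℕ) (α * r + β) y := by
  have hk' : (0 : ℝ) < k := by exact_mod_cast hk
  have hG := Real.Gamma_pos_of_pos hk'
  have hG2 : 0 < Real.Gamma (2 * k) := Real.Gamma_pos_of_pos (by positivity)
  have hs : 0 < α * r + β := by positivity
  unfold gammaPDF
  rw [← ENNReal.ofReal_mul hy.le,
    ← ENNReal.ofReal_mul (gammaPDFReal_nonneg hk' hβ y),
    ← ENNReal.ofReal_mul (by unfold gammaRatioPDFReal; positivity)]
  congr 1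
  rw [gammaPDFReal_natCast hk _ hy.le, gammaPDFReal_natCast hk _ (by positivity),
    gammaPDFReal_natCast (by omega) _ hy.le, gammaRatioPDFReal]
  have he : Real.exp (-((α * r + β) * y)) = Real.exp (-(β * y)) * Real.exp (-(α * (y * r))) := by
    rw [← Real.exp_add]; congr 1; ring
  obtain ⟨n, rfl⟩ : ∃ n, k = n + 1 := ⟨k - 1, by omega⟩
  have h2 : 2 * (n + 1) - 1 = n + n + 1 := by omega
  rw [he, h2]
  push_cast at hG hG2 ⊢
  field_simp
  ring

lemma setLIntegral_Ioi_eq_mul {f : ℝ → ENNReal} {y : ℝ} (hy : 0 < y) :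
    ∫⁻ x in Set.Ioi y, f x = ∫⁻ r in Set.Ioi 1, ENNReal.ofReal y * f (y * r) := by
  have himg : (fun r => y * r) '' Set.Ioi 1 = Set.Ioi y := by
    rw [Set.image_mul_left_Ioi hy, mul_one]
  rw [← himg, lintegral_image_eq_lintegral_abs_deriv_mul measurableSet_Ioi
    (f' := fun _ => y) (fun x _ => by simpa using ((hasDerivAt_id x).const_mul y).hasDerivWithinAt)
    (mul_right_injective₀ hy.ne').injOn, abs_of_pos hy]

lemma gammaMeasure_prod_lt {k : ℕ} (hk : 0 < k) {α β : ℝ} (hα : 0 < α) (hβ : 0 < β) :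
    ((gammaMeasure k α).prod (gammaMeasure k β)) {p | p.2 < p.1}
      = ∫⁻ r in Set.Ioi 1, ENNReal.ofReal (gammaRatioPDFReal k α β r) := by
  have hk' : (0 : ℝ) < k := by exact_mod_cast hk
  have := isProbabilityMeasure_gammaMeasure hk' hα
  have := isProbabilityMeasure_gammaMeasure hk' hβ
  have hS : MeasurableSet {p : ℝ × ℝ | p.2 < p.1} := measurableSet_lt measurable_snd measurable_fst
  have hmeas (a r : ℝ) : Measurable (gammaPDF a r) := (measurable_gammaPDFReal a r).ennreal_ofReal
  rw [Measure.prod_apply_symm hS, lintegral_gammaMeasure _ _ (measurable_measure_prodMk_right hS)]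
  have h1 : ∀ y ∈ Set.Ioi (0 : ℝ),
      gammaPDF k β y * gammaMeasure k α ((fun x => (x, y)) ⁻¹' {p | p.2 < p.1})
      = ∫⁻ r in Set.Ioi 1, gammaPDF k β y * (ENNReal.ofReal y * gammaPDF k α (y * r)) := by
    intro y hy
    have hpre : (fun x => (x, y)) ⁻¹' {p : ℝ × ℝ | p.2 < p.1} = Set.Ioi y := by
      ext x; simp
    rw [hpre, gammaMeasure, withDensity_apply _ measurableSet_Ioi, setLIntegral_Ioi_eq_mul hy,
      lintegral_const_mul' (gammaPDF k β y) _ ENNReal.ofReal_ne_top]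
  rw [setLIntegral_congr_fun measurableSet_Ioi h1, lintegral_lintegral_swap]
  · refine setLIntegral_congr_fun measurableSet_Ioi fun r hr => ?_
    have hr : 0 < r := zero_lt_one.trans hr
    rw [setLIntegral_congr_fun measurableSet_Ioi
      fun y hy => gammaPDF_mul_gammaPDF hk hα hβ hr hy,
      lintegral_const_mul' _ _ ENNReal.ofReal_ne_top,
      setLIntegral_gammaPDF_Ioi_zero (by positivity) (by positivity), mul_one]
  · have := hmeas k α
    have := hmeas k β
    fun_prop

lemma gamma_two_mul_div_sq {k : ℕ} (hk : 0 < k) :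
    Real.Gamma (2 * k) / Real.Gamma k ^ 2 = k * (k.centralBinom / 2) := by
  obtain ⟨n, rfl⟩ : ∃ n, k = n + 1 := ⟨k - 1, by omega⟩
  have h1 : Real.Gamma (2 * ((n + 1 : ℕ) : ℝ)) = (2 * n + 1).factorial := by
    rw [← Real.Gamma_nat_eq_factorial]; congr 1; push_cast; ring
  have h2 : Real.Gamma ((n + 1 : ℕ) : ℝ) = n.factorial := by
    rw [← Real.Gamma_nat_eq_factorial]; push_cast; rfl
  have h3 := Nat.choose_mul_factorial_mul_factorial (n := 2 * (n + 1)) (k := n + 1) (by omega)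
  have h4 : 2 * (n + 1) - (n + 1) = n + 1 := by omega
  rw [h4, ← Nat.centralBinom_eq_two_mul_choose, show 2 * (n + 1) = (2 * n + 1) + 1 by ring,
    Nat.factorial_succ (2 * n + 1), Nat.factorial_succ n] at h3
  have h5 : ((n + 1).centralBinom : ℝ) * ((n + 1) * n.factorial) * ((n + 1) * n.factorial)
      = (2 * n + 1 + 1) * (2 * n + 1).factorial := by exact_mod_cast h3
  have hf : (n.factorial : ℝ) ≠ 0 := by exact_mod_cast n.factorial_ne_zero
  rw [h1, h2, div_eq_iff (by positivity)]
  have hn : (n + 1 : ℝ) ≠ 0 := by positivity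
  push_cast
  refine mul_left_cancel₀ hn ?_
  linear_combination -h5 / 2

lemma hasDerivAt_div_sq_pow (k : ℕ) {α β r : ℝ} (hs : α * r + β ≠ 0) :
    HasDerivAt (fun r => -(r / (α * r + β) ^ 2) ^ k)
      (k * (r / (α * r + β) ^ 2) ^ (k - 1) * ((α * r - β) / (α * r + β) ^ 3)) r := by
  have h1 : HasDerivAt (fun r => α * r + β) α r := by
    simpa using ((hasDerivAt_id r).const_mul α).add_const β
  have h2 := (((hasDerivAt_id r).div (h1.pow 2) (pow_ne_zero 2 hs)).pow k).neg
  refine h2.congr_deriv ?_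
  simp only [id, Pi.pow_apply]
  rw [← mul_neg]
  congr 1
  field_simp
  push_cast
  ring

lemma gammaRatioPDFReal_le {k : ℕ} (hk : 0 < k) {α β r : ℝ} (hβ : 0 < β) (hαβ : β < α)
    (hr : 1 < r) :
    gammaRatioPDFReal k α β r ≤ k.centralBinom / 2 * (α * β) ^ k * ((α + β) / (α - β)) *
      (k * (r / (α * r + β) ^ 2) ^ (k - 1) * ((α * r - β) / (α * r + β) ^ 3)) := by
  have hα : 0 < α := hβ.trans hαβ
  have hr0 : 0 < r := by positivity
  have hs : 0 < α * r + β := by positivity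
  have hd : 0 < α - β := sub_pos.2 hαβ
  have h1 : 1 ≤ (α + β) / (α - β) * ((α * r - β) / (α * r + β)) := by
    rw [div_mul_div_comm, one_le_div (by positivity)]
    nlinarith [mul_pos (mul_pos hα hβ) (sub_pos.2 hr)]
  have h2 : gammaRatioPDFReal k α β r = k.centralBinom / 2 * (α * β) ^ k *
      (k * (r / (α * r + β) ^ 2) ^ (k - 1) / (α * r + β) ^ 2) := by
    rw [gammaRatioPDFReal, gamma_two_mul_div_sq hk]
    obtain ⟨n, rfl⟩ : ∃ n, k = n + 1 := ⟨k - 1, by omega⟩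
    simp only [add_tsub_cancel_right, div_pow, ← pow_mul]
    field_simp
    ring
  have h3 : 0 ≤ gammaRatioPDFReal k α β r := by rw [h2]; positivity
  calc gammaRatioPDFReal k α β r
      ≤ gammaRatioPDFReal k α β r * ((α + β) / (α - β) * ((α * r - β) / (α * r + β))) :=
        le_mul_of_one_le_right h3 h1
    _ = _ := by rw [h2]; field_simp

lemma tendsto_div_sq_pow {k : ℕ} (hk : 0 < k) {α β : ℝ} (hα : 0 < α) (hβ : 0 < β) :
    Filter.Tendsto (fun r : ℝ => -(r / (α * r + β) ^ 2) ^ k) Filter.atTop (nhds 0) := by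
  have h : Filter.Tendsto (fun r : ℝ => r / (α * r + β) ^ 2) Filter.atTop (nhds 0) := by
    refine squeeze_zero' (g := fun r : ℝ => (α ^ 2)⁻¹ * r⁻¹) ?_ ?_
      (by simpa using tendsto_inv_atTop_zero.const_mul (α ^ 2)⁻¹)
    · filter_upwards [Filter.eventually_gt_atTop 0] with r hr
      positivity
    · filter_upwards [Filter.eventually_gt_atTop 0] with r hr
      rw [← mul_inv, ← one_div, div_le_div_iff₀ (by positivity) (by positivity)]
      nlinarith [mul_pos (mul_pos hα hβ) hr, sq_nonneg β]
  simpa [hk.ne'] using (h.pow k).neg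

/-- Tail bound for the ratio of two independent Gamma variables of the same integer shape. -/
lemma gammaMeasure_prod_lt_le {k : ℕ} (hk : 0 < k) {α β : ℝ} (hβ : 0 < β) (hαβ : β < α) :
    ((gammaMeasure k α).prod (gammaMeasure k β)) {p | p.2 < p.1}
      ≤ ENNReal.ofReal
        (k.centralBinom / 2 * ((α + β) / (α - β)) * (α * β / (α + β) ^ 2) ^ k) := by
  have hα : 0 < α := hβ.trans hαβ
  have hd : 0 < α - β := sub_pos.2 hαβ
  have hs : ∀ r ∈ Set.Ici (1 : ℝ), α * r + β ≠ 0 := fun r hr => by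
    have : 0 < r := zero_lt_one.trans_le hr
    positivity
  have hderiv := fun r hr => hasDerivAt_div_sq_pow k (hs r hr)
  have hnonneg : ∀ r ∈ Set.Ioi (1 : ℝ),
      0 ≤ k * (r / (α * r + β) ^ 2) ^ (k - 1) * ((α * r - β) / (α * r + β) ^ 3) := fun r hr => by
    have hr : 1 < r := hr
    have : 0 < α * r - β := by nlinarith
    positivity
  have hderiv' := fun r (hr : r ∈ Set.Ioi (1 : ℝ)) => hderiv r (Set.mem_Ici_of_Ioi hr)
  have hcont := (hderiv 1 Set.self_mem_Ici).continuousAt.continuousWithinAt (s := Set.Ici 1)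
  have hlim := tendsto_div_sq_pow hk hα hβ
  have hint := integrableOn_Ioi_deriv_of_nonneg hcont hderiv' hnonneg hlim
  have hval := integral_Ioi_of_hasDerivAt_of_nonneg hcont hderiv' hnonneg hlim
  rw [gammaMeasure_prod_lt hk hα hβ]
  calc ∫⁻ r in Set.Ioi 1, ENNReal.ofReal (gammaRatioPDFReal k α β r)
      ≤ ∫⁻ r in Set.Ioi 1, ENNReal.ofReal
          (k.centralBinom / 2 * (α * β) ^ k * ((α + β) / (α - β)) *
          (k * (r / (α * r + β) ^ 2) ^ (k - 1) * ((α * r - β) / (α * r + β) ^ 3))) :=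
        setLIntegral_mono' measurableSet_Ioi fun r hr =>
          ENNReal.ofReal_le_ofReal (gammaRatioPDFReal_le hk hβ hαβ hr)
    _ = _ := by
      rw [← ofReal_integral_eq_lintegral_ofReal (hint.const_mul _), integral_const_mul, hval]
      · congr 1
        simp only [mul_one, sub_neg_eq_add, zero_add, div_pow, mul_pow]
        ring
      · filter_upwards [ae_restrict_mem measurableSet_Ioi] with r hr
        exact mul_nonneg (by positivity) (hnonneg r hr)

lemma centralBinom_sq_mul_le (k : ℕ) : k.centralBinom ^ 2 * (2 * k + 1) ≤ 16 ^ k := by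
  induction k with
  | zero => simp
  | succ n ih =>
    have h := Nat.succ_mul_centralBinom_succ n
    refine Nat.le_of_mul_le_mul_left ?_ (by positivity : 0 < (n + 1) ^ 2)
    calc (n + 1) ^ 2 * ((n + 1).centralBinom ^ 2 * (2 * (n + 1) + 1))
        = ((n + 1) * (n + 1).centralBinom) ^ 2 * (2 * n + 3) := by ring
      _ = n.centralBinom ^ 2 * (2 * n + 1) * (4 * ((2 * n + 1) * (2 * n + 3))) := by rw [h]; ring
      _ ≤ 16 ^ n * (4 * (4 * (n + 1) ^ 2)) := Nat.mul_le_mul ih (Nat.mul_le_mul_left 4 (by nlinarith))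
      _ = (n + 1) ^ 2 * 16 ^ (n + 1) := by ring

lemma centralBinom_mul_le_div_sqrt {k : ℕ} (hk : 2 ≤ k) {a b : ℝ} (ha : 0 < a) (hb : 0 < b) :
    k.centralBinom / 2 * (a + b) * (a * b / (a + b) ^ 2) ^ k ≤ 1 / Real.sqrt (k - 1) * a := by
  have hk1 : (0 : ℝ) < k - 1 := by
    have : (2 : ℝ) ≤ k := by exact_mod_cast hk
    linarith
  obtain ⟨n, rfl⟩ : ∃ n, k = n + 2 := ⟨k - 2, by omega⟩
  set q := a * b / (a + b) ^ 2 with hq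
  have hq0 : 0 ≤ q := by positivity
  have hq4 : q ≤ 1 / 4 := by
    rw [hq, div_le_div_iff₀ (by positivity) (by norm_num)]
    nlinarith [sq_nonneg (a - b)]
  have hq2 : (a + b) * q ^ 2 ≤ 4 / 27 * a := by
    have : (a + b) * q ^ 2 = a ^ 2 * b ^ 2 / (a + b) ^ 3 := by rw [hq]; field_simp
    rw [this, div_le_iff₀ (by positivity)]
    have h : 0 ≤ a * ((2 * a - b) ^ 2 * (a + 4 * b)) := by positivity
    nlinarith
  have hC : ((n + 2).centralBinom : ℝ) * (1 / 4) ^ (n + 2) * (32 / 27)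
      ≤ 1 / Real.sqrt ((n + 2 : ℕ) - 1) := by
    rw [le_div_iff₀ (Real.sqrt_pos.2 hk1)]
    refine abs_le_of_sq_le_sq' ?_ zero_le_one |>.2
    have h : ((n + 2).centralBinom : ℝ) ^ 2 * (2 * (n + 2 : ℕ) + 1) ≤ 16 ^ (n + 2) := by
      exact_mod_cast centralBinom_sq_mul_le (n + 2)
    have h16 : ((1 / 4 : ℝ) ^ (n + 2)) ^ 2 = 1 / 16 ^ (n + 2) := by
      rw [← pow_mul, mul_comm, pow_mul, ← one_div_pow]; norm_num
    rw [mul_pow, Real.sq_sqrt hk1.le, mul_pow, mul_pow, h16, one_pow, mul_one_div,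
      div_mul_eq_mul_div, div_mul_eq_mul_div, div_le_one (by positivity)]
    refine le_trans ?_ h
    rw [mul_assoc]
    gcongr
    push_cast
    linarith
  calc (n + 2).centralBinom / 2 * (a + b) * q ^ (n + 2)
      = (n + 2).centralBinom / 2 * ((a + b) * q ^ 2) * q ^ n := by ring
    _ ≤ (n + 2).centralBinom / 2 * (4 / 27 * a) * (1 / 4) ^ n := by gcongr
    _ = (n + 2).centralBinom * (1 / 4) ^ (n + 2) * (32 / 27) * a := by ring
    _ ≤ _ := by gcongr

lemma integral_min_le_of_map_eq_gammaMeasure {Ω : Type*} [MeasurableSpace Ω] {P : Measure Ω}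
    {τ₁ τ₂ : Ω → ℝ} (hτ₁ : Measurable τ₁) (hτ₂ : Measurable τ₂) {c r d s : ℝ}
    (hc : 0 < c) (hr : 0 < r) (hd₁ : P.map τ₁ = gammaMeasure c r)
    (hd₂ : P.map τ₂ = gammaMeasure d s) :
    ∫ ω, min (τ₁ ω) (τ₂ ω) ∂P ≤ c / r := by
  have h1 : ∀ᵐ ω ∂P, 0 < τ₁ ω :=
    ae_of_ae_map hτ₁.aemeasurable (hd₁ ▸ ae_pos_gammaMeasure c r)
  have h2 : ∀ᵐ ω ∂P, 0 < τ₂ ω :=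
    ae_of_ae_map hτ₂.aemeasurable (hd₂ ▸ ae_pos_gammaMeasure d s)
  rw [integral_eq_lintegral_of_nonneg_ae
    (by filter_upwards [h1, h2] with ω a b using le_min a.le b.le)
    (hτ₁.min hτ₂).aestronglyMeasurable]
  refine ENNReal.toReal_le_of_le_ofReal (by positivity) ?_
  calc ∫⁻ ω, ENNReal.ofReal (min (τ₁ ω) (τ₂ ω)) ∂P
      ≤ ∫⁻ ω, ENNReal.ofReal (τ₁ ω) ∂P := by gcongr; exact min_le_left _ _
    _ = ENNReal.ofReal (c / r) := by
      rw [← lintegral_ofReal_gammaMeasure hc hr, ← hd₁,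
        lintegral_map ENNReal.measurable_ofReal hτ₁]

open MeasureTheory ProbabilityTheory in
/-- Expected mutual delay bound for two jobs in the stochastic progress bar model. -/
theorem stmt_11 (k : ℕ) (hk : 4 ≤ k) (g : ℝ) (hg : 0 < g) (a b : ℝ)
    (ha : 0 < a) (hab : a ≤ b)
    {Ω : Type*} [MeasurableSpace Ω] (P : Measure Ω) [IsProbabilityMeasure P]
    (τ₁ τ₂ : Ω → ℝ) (hτ₁ : Measurable τ₁) (hτ₂ : Measurable τ₂)
    (hind : IndepFun τ₁ τ₂ P)
    (hd₁ : P.map τ₁ = gammaMeasure (k : ℝ) (g / a))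
    (hd₂ : P.map τ₂ = gammaMeasure (k : ℝ) (g / b)) :
    (∫ ω, min (τ₁ ω) (τ₂ ω) ∂P) + (b - a) * (P {ω | τ₂ ω < τ₁ ω}).toReal
      ≤ ((k : ℝ) / g + 1 / Real.sqrt ((k : ℝ) - 1)) * a := by
  have hb : 0 < b := ha.trans_le hab
  have hk0 : 0 < k := by omega
  have hmin := integral_min_le_of_map_eq_gammaMeasure hτ₁ hτ₂ (by positivity : (0 : ℝ) < k)
    (by positivity) hd₁ hd₂
  have hdelay : (b - a) * (P {ω | τ₂ ω < τ₁ ω}).toReal ≤ 1 / Real.sqrt ((k : ℝ) - 1) * a := by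
    rcases hab.eq_or_lt with rfl | hlt
    · rw [sub_self, zero_mul]
      positivity
    have hba : 0 < b - a := sub_pos.2 hlt
    have hrate : g / b < g / a := div_lt_div_of_pos_left hg ha hlt
    have hP : P {ω | τ₂ ω < τ₁ ω}
        = ((gammaMeasure k (g / a)).prod (gammaMeasure k (g / b))) {p | p.2 < p.1} := by
      rw [← hd₁, ← hd₂,
        ← (indepFun_iff_map_prod_eq_prod_map_map hτ₁.aemeasurable hτ₂.aemeasurable).1 hind,
        Measure.map_apply (hτ₁.prodMk hτ₂) (measurableSet_lt measurable_snd measurable_fst)]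
      rfl
    have hdiff : g / a - g / b = g * (b - a) / (a * b) := by field_simp
    have hsum : g / a + g / b = g * (a + b) / (a * b) := by field_simp; ring
    have hratio : (g / a + g / b) / (g / a - g / b) = (a + b) / (b - a) := by
      rw [hdiff, hsum]; field_simp
    have hprod : g / a * (g / b) / (g / a + g / b) ^ 2 = a * b / (a + b) ^ 2 := by
      rw [hsum]; field_simp
    have hle := gammaMeasure_prod_lt_le hk0 (by positivity) hrate
    rw [← hP, hratio, hprod] at hle
    calc (b - a) * (P {ω | τ₂ ω < τ₁ ω}).toReal
        ≤ (b - a) * (k.centralBinom / 2 * ((a + b) / (b - a)) * (a * b / (a + b) ^ 2) ^ k) := by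
          gcongr
          exact ENNReal.toReal_le_of_le_ofReal (by positivity) hle
      _ = k.centralBinom / 2 * (a + b) * (a * b / (a + b) ^ 2) ^ k := by field_simp
      _ ≤ _ := centralBinom_mul_le_div_sqrt (by omega) ha hb
  calc _ ≤ k / (g / a) + 1 / Real.sqrt ((k : ℝ) - 1) * a := add_le_add hmin hdelay
    _ = _ := by field_simp
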